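/- Let k be a field, n ≥ 1, A = k[x₁,…,xₙ], and set R = A/(x₁x₂⋯xₙ), R₁ = A/(x₁), R₂ = A/(x₂⋯xₙ). Then for every i ≥ 1 the A-linear map φ : Ω^i_R/tors → (Ω^i_{R₂}/tors) ⊕ Ω^i_{R₁}, given in both coordinates by the canonical restriction maps induced by the ring quotients R → R₂ and R → R₁, is injective. -/

import Mathlib

set_option maxHeartbeats 1000000
set_option synthInstance.maxHeartbeats 400000

open ExteriorAlgebra MvPolynomial

noncomputable section

/-- `Ω^i_S`: the `i`-th exterior power (over `S`) of the module of Kähler differentials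
of a `k`-algebra `S`. -/
abbrev OmegaPow (k : Type*) [CommRing k] (S : Type*) [CommRing S] [Algebra k S] (i : ℕ) :=
  ↥(⋀[S]^i (Ω[S⁄k]))

/-- The generator `s₀ • (d s₁ ∧ ⋯ ∧ d sᵢ)` of `Ω^i_S`. -/
def omegaGen (k : Type*) [CommRing k] (S : Type*) [CommRing S] [Algebra k S] (i : ℕ)
    (s₀ : S) (v : Fin i → S) : OmegaPow k S i :=
  s₀ • ⟨ExteriorAlgebra.ιMulti S i (fun t => KaehlerDifferential.D k S (v t)),
    ExteriorAlgebra.ιMulti_range S i (Set.mem_range_self _)⟩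

/-- `Ω^i_S / torsion`: the quotient of `Ω^i_S` by its torsion submodule (elements annihilated
by some nonzerodivisor). -/
abbrev OmegaPowModTors (k : Type*) [CommRing k] (S : Type*) [CommRing S] [Algebra k S]
    (i : ℕ) :=
  OmegaPow k S i ⧸ Submodule.torsion S (OmegaPow k S i)

/-- The class of the generator `s₀ • (d s₁ ∧ ⋯ ∧ d sᵢ)` in `Ω^i_S / torsion`. -/
def omegaGenTors (k : Type*) [CommRing k] (S : Type*) [CommRing S] [Algebra k S] (i : ℕ)
    (s₀ : S) (v : Fin i → S) : OmegaPowModTors k S i :=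
  Submodule.Quotient.mk (omegaGen k S i s₀ v)

/-- The polynomial ring `A = k[x₁, …, x_{n+1}]`. -/
abbrev polyA (k : Type*) [Field k] (n : ℕ) := MvPolynomial (Fin (n + 1)) k

/-- The ideal `(x₁ ⋯ x_{n+1})` of `A`. -/
abbrev idealR (k : Type*) [Field k] (n : ℕ) : Ideal (polyA k n) :=
  Ideal.span {∏ j, X j}

/-- The ideal `(x₁)` of `A`. -/
abbrev idealR1 (k : Type*) [Field k] (n : ℕ) : Ideal (polyA k n) :=
  Ideal.span {X 0}

/-- The ideal `(x₂ ⋯ x_{n+1})` of `A`. -/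
abbrev idealR2 (k : Type*) [Field k] (n : ℕ) : Ideal (polyA k n) :=
  Ideal.span {∏ j ∈ Finset.univ.erase 0, X j}

/-- `R = A/(x₁ ⋯ x_{n+1})`, the coordinate ring of the simple normal crossing divisor `E`. -/
abbrev ringR (k : Type*) [Field k] (n : ℕ) := polyA k n ⧸ idealR k n

/-- `R₁ = A/(x₁)`, the coordinate ring of the component `E₁`. -/
abbrev ringR1 (k : Type*) [Field k] (n : ℕ) := polyA k n ⧸ idealR1 k n

/-- `R₂ = A/(x₂ ⋯ x_{n+1})`, the coordinate ring of the union `E₁ᶜ` of the other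
components. -/
abbrev ringR2 (k : Type*) [Field k] (n : ℕ) := polyA k n ⧸ idealR2 k n

end

section Functoriality

variable {k S T : Type*} [CommRing k] [CommRing S] [Algebra k S] [CommRing T] [Algebra k T]

/-- The semilinear map `Ω_S → Ω_T` induced by a `k`-algebra morphism `S → T`. -/
noncomputable def kaehlerMap (f : S →ₐ[k] T) : Ω[S⁄k] →ₛₗ[(f : S →+* T)] Ω[T⁄k] :=
  letI : Algebra S T := (f : S →+* T).toAlgebra
  haveI : IsScalarTower k S T := IsScalarTower.of_algebraMap_eq fun r => (f.commutes r).symm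
  { toFun := KaehlerDifferential.map k k S T
    map_add' := map_add _
    map_smul' := fun s m => by
      rw [map_smul, ← algebraMap_smul T s]
      rfl }

@[simp]
lemma kaehlerMap_D (f : S →ₐ[k] T) (s : S) :
    kaehlerMap f (KaehlerDifferential.D k S s) = KaehlerDifferential.D k T (f s) :=
  letI : Algebra S T := (f : S →+* T).toAlgebra
  haveI : IsScalarTower k S T := IsScalarTower.of_algebraMap_eq fun r => (f.commutes r).symm
  KaehlerDifferential.map_D k k S T s

lemma kaehler_induction {P : Ω[S⁄k] → Prop} (D : ∀ s, P (KaehlerDifferential.D k S s))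
    (zero : P 0) (add : ∀ x y, P x → P y → P (x + y)) (smul : ∀ (s : S) x, P x → P (s • x))
    (x : Ω[S⁄k]) : P x := by
  have hx : x ∈ Submodule.span S (Set.range (KaehlerDifferential.D k S)) := by
    rw [KaehlerDifferential.span_range_derivation]; trivial
  induction hx using Submodule.span_induction with
  | mem x h => obtain ⟨s, rfl⟩ := h; exact D s
  | zero => exact zero
  | add x y _ _ hx hy => exact add x y hx hy
  | smul s x _ hx => exact smul s x hx

/-- The restriction map `Ω^i_S → Ω^i_T` induced by a `k`-algebra morphism `S → T`. -/
noncomputable def omegaMap (f : S →ₐ[k] T) (i : ℕ) :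
    OmegaPow k S i →ₛₗ[(f : S →+* T)] OmegaPow k T i :=
  letI : Module S (OmegaPow k T i) := Module.compHom _ (f : S →+* T)
  let F : (Ω[S⁄k]) [⋀^Fin i]→ₗ[S] (OmegaPow k T i) :=
    { toFun := fun m => exteriorPower.ιMulti T i fun t => kaehlerMap f (m t)
      map_update_add' := fun m t x y => by
        have h (z) : (fun j => kaehlerMap f (Function.update m t z j)) =
          Function.update (fun j => kaehlerMap f (m j)) t (kaehlerMap f z) :=
          funext fun j => Function.apply_update (fun _ => kaehlerMap f) m t z j
        simp only [h, map_add, AlternatingMap.map_update_add]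
      map_update_smul' := fun m t s x => by
        have h (z) : (fun j => kaehlerMap f (Function.update m t z j)) =
          Function.update (fun j => kaehlerMap f (m j)) t (kaehlerMap f z) :=
          funext fun j => Function.apply_update (fun _ => kaehlerMap f) m t z j
        simp only [h, LinearMap.map_smulₛₗ, AlternatingMap.map_update_smul]
        rfl
      map_eq_zero_of_eq' := fun m a b hab hne =>
        AlternatingMap.map_eq_zero_of_eq _ _ (by rw [hab]) hne }
  { toFun := exteriorPower.alternatingMapLinearEquiv F
    map_add' := map_add _
    map_smul' := fun s m => map_smul _ s m }

@[simp]
lemma omegaMap_ιMulti (f : S →ₐ[k] T) (i : ℕ) (m : Fin i → Ω[S⁄k]) :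
    omegaMap f i (exteriorPower.ιMulti S i m) =
      exteriorPower.ιMulti T i fun t => kaehlerMap f (m t) :=
  letI : Module S (OmegaPow k T i) := Module.compHom _ (f : S →+* T)
  exteriorPower.alternatingMapLinearEquiv_apply_ιMulti _ m

lemma omegaPow_induction {i : ℕ} {P : OmegaPow k S i → Prop}
    (ιMulti : ∀ m, P (exteriorPower.ιMulti S i m))
    (zero : P 0) (add : ∀ x y, P x → P y → P (x + y)) (smul : ∀ (s : S) x, P x → P (s • x))
    (x : OmegaPow k S i) : P x := by
  have hx : x ∈ Submodule.span S (Set.range (exteriorPower.ιMulti S i (M := Ω[S⁄k]))) := by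
    rw [exteriorPower.ιMulti_span]; trivial
  induction hx using Submodule.span_induction with
  | mem x h => obtain ⟨s, rfl⟩ := h; exact ιMulti s
  | zero => exact zero
  | add x y _ _ hx hy => exact add x y hx hy
  | smul s x _ hx => exact smul s x hx

lemma omegaMap_omegaGen (f : S →ₐ[k] T) (i : ℕ) (s : S) (v : Fin i → S) :
    omegaMap f i (omegaGen k S i s v) = omegaGen k T i (f s) fun t => f (v t) := by
  have h := omegaMap_ιMulti f i fun t => KaehlerDifferential.D k S (v t)
  simp only [kaehlerMap_D] at h
  exact (LinearMap.map_smulₛₗ (omegaMap f i) s _).trans (congrArg (f s • ·) h)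

/-- The map on `Ω^i` induced by a morphism with a left inverse is injective. -/
lemma omegaMap_injective_of_leftInverse (f : S →ₐ[k] T) (g : T →ₐ[k] S)
    (hgf : ∀ s, g (f s) = s) (i : ℕ) : Function.Injective (omegaMap f i) := by
  refine Function.LeftInverse.injective (g := omegaMap g i) fun ω => ?_
  have h1 (x : Ω[S⁄k]) : kaehlerMap g (kaehlerMap f x) = x := by
    induction x using kaehler_induction with
    | D s => simp [hgf]
    | zero => simp
    | add x y hx hy => rw [map_add, map_add, hx, hy]
    | smul s x hx => simp [LinearMap.map_smulₛₗ, hx, hgf]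
  induction ω using omegaPow_induction with
  | ιMulti m => simp [h1]
  | zero => simp
  | add x y hx hy => rw [map_add, map_add, hx, hy]
  | smul s x hx => simp [LinearMap.map_smulₛₗ, hx, hgf]

end Functoriality

section Kernel

variable {k B C : Type*} [CommRing k] [CommRing B] [Algebra k B] [CommRing C] [Algebra k C]

/-- A `B`-module on which the action only depends on images under a surjection `B → C` is a
`C`-module. -/
noncomputable abbrev moduleOfSurjective {M : Type*} [AddCommMonoid M] [Module B M] (f : B →+* C)
    (hf : Function.Surjective f) (h : ∀ b b', f b = f b' → ∀ m : M, b • m = b' • m) :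
    Module C M :=
  letI : SMul C M := ⟨fun c m => Function.surjInv hf c • m⟩
  hf.moduleLeft f fun c x => h _ c (Function.surjInv_eq hf (f c)) x

lemma moduleOfSurjective_smul {M : Type*} [AddCommMonoid M] [Module B M] (f : B →+* C)
    (hf : Function.Surjective f) (h : ∀ b b', f b = f b' → ∀ m : M, b • m = b' • m)
    (b : B) (m : M) :
    letI := moduleOfSurjective f hf h
    f b • m = b • m :=
  h _ b (Function.surjInv_eq hf (f b)) m

/-- The action on elements killed by the kernel of `f` only depends on images under `f`. -/
lemma smul_eq_smul_of_mem_torsionBySet_ker {M : Type*} [AddCommGroup M] [Module B M]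
    (f : B →+* C) (b b' : B) (hb : f b = f b')
    (m : Submodule.torsionBySet B M {b | f b = 0}) : b • m = b' • m := by
  have h := (Submodule.mem_torsionBySet_iff _ _).1 m.2
    ⟨b - b', by rw [Set.mem_ofPred_eq, map_sub, hb, sub_self]⟩
  rw [sub_smul, sub_eq_zero] at h
  exact Subtype.ext h

/-- If `q` annihilates the kernel of `B → C`, then a power of `q` annihilates the kernel of
`Ω^i_B → Ω^i_C`: there is a map back whose composite with the restriction is multiplication
by `q ^ (2 i)`. -/
lemma pow_smul_eq_zero_of_omegaMap_eq_zero (f : B →ₐ[k] C) (hf : Function.Surjective f) (q : B)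
    (hq : ∀ b, f b = 0 → q * b = 0) {i : ℕ} (hi : 1 ≤ i) (ω : OmegaPow k B i)
    (hω : omegaMap f i ω = 0) : (q ^ 2) ^ i • ω = 0 := by
  classical
  let K : Set B := {b | (f : B →+* C) b = 0}
  let N₁ := Submodule.torsionBySet B (Ω[B⁄k]) K
  let N := Submodule.torsionBySet B (OmegaPow k B i) K
  have hN₁ := smul_eq_smul_of_mem_torsionBySet_ker (M := Ω[B⁄k]) (f : B →+* C)
  have hN := smul_eq_smul_of_mem_torsionBySet_ker (M := OmegaPow k B i) (f : B →+* C)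
  let _ : Module C N₁ := moduleOfSurjective (f : B →+* C) hf hN₁
  let _ : Module C N := moduleOfSurjective (f : B →+* C) hf hN
  have smul₁ (b : B) (m : N₁) : f b • m = b • m :=
    moduleOfSurjective_smul (f : B →+* C) hf hN₁ b m
  have smulN (b : B) (m : N) : f b • m = b • m :=
    moduleOfSurjective_smul (f : B →+* C) hf hN b m
  have : IsScalarTower k C N₁ := ⟨fun r c m => by
    obtain ⟨b, rfl⟩ := hf c
    rw [← map_smul, smul₁, smul₁, smul_assoc]⟩
  have hd (b b' : B) (h : f b = f b') :
      q ^ 2 • KaehlerDifferential.D k B b = q ^ 2 • KaehlerDifferential.D k B b' := by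
    have h0 : q * (b - b') = 0 := hq _ (by rw [map_sub, h, sub_self])
    have h1 : q • KaehlerDifferential.D k B (q * (b - b')) = 0 := by
      rw [h0, map_zero, smul_zero]
    rw [Derivation.leibniz, smul_add, smul_smul, smul_smul, h0, zero_smul, add_zero, map_sub,
      smul_sub, ← pow_two] at h1
    exact sub_eq_zero.1 h1
  have hmem (x : Ω[B⁄k]) : q ^ 2 • x ∈ N₁ := by
    rw [Submodule.mem_torsionBySet_iff]
    rintro ⟨b, hb⟩
    rw [smul_smul, show b * q ^ 2 = q * b * q by ring, hq b hb, zero_mul, zero_smul]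
  let g : B → N₁ := fun b => ⟨q ^ 2 • KaehlerDifferential.D k B b, hmem _⟩
  have hg (b b' : B) (h : f b = f b') : g b = g b' := Subtype.ext (hd b b' h)
  let s : C → B := Function.surjInv hf
  have hs (c : C) : f (s c) = c := Function.surjInv_eq hf c
  let D' : Derivation k C N₁ := Derivation.mk'
    { toFun := fun c => g (s c)
      map_add' := fun c c' => by
        rw [hg (s (c + c')) (s c + s c') (by simp [hs])]
        exact Subtype.ext (by simp [g])
      map_smul' := fun r c => by
        rw [hg (s (r • c)) (r • s c) (by simp [hs])]
        exact Subtype.ext ((congrArg (q ^ 2 • ·) (Derivation.map_smul _ r _)).trans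
          (smul_comm _ _ _)) }
    (fun c c' => by
      change g (s (c * c')) = c • g (s c') + c' • g (s c)
      rw [hg (s (c * c')) (s c * s c') (by simp [hs])]
      conv_rhs => rw [← hs c, ← hs c', smul₁, smul₁, hs, hs]
      exact Subtype.ext (by simp [g, smul_comm (q ^ 2)]))
  let ψ := D'.liftKaehlerDifferential
  have hψ (x : Ω[B⁄k]) : (ψ (kaehlerMap f x) : Ω[B⁄k]) = q ^ 2 • x := by
    induction x using kaehler_induction with
    | D b =>
      rw [kaehlerMap_D, Derivation.liftKaehlerDifferential_comp_D]
      exact congrArg Subtype.val (hg (s (f b)) b (hs _))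
    | zero => simp
    | add x y hx hy => rw [map_add, map_add, Submodule.coe_add, hx, hy, smul_add]
    | smul b x hx =>
      rw [LinearMap.map_smulₛₗ, map_smul]
      change ((f b • ψ (kaehlerMap f x) : N₁) : Ω[B⁄k]) = _
      rw [smul₁, Submodule.coe_smul, hx, smul_comm]
  let G₀ : N₁ [⋀^Fin i]→ₗ[B] N :=
    ((exteriorPower.ιMulti B i).compLinearMap N₁.subtype).codRestrict N fun m => by
      rw [Submodule.mem_torsionBySet_iff]
      rintro ⟨b, hb⟩
      have h := ((exteriorPower.ιMulti B i).compLinearMap N₁.subtype).map_update_smul m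
        ⟨0, hi⟩ b (m ⟨0, hi⟩)
      rw [Function.update_eq_self] at h
      rw [← h, hN₁ b 0 (hb.trans (map_zero _).symm), zero_smul]
      exact AlternatingMap.map_update_zero _ _ _
  let G : N₁ [⋀^Fin i]→ₗ[C] N :=
    { toFun := G₀
      map_update_add' := fun m t x y => by
        convert G₀.map_update_add m t x y
      map_update_smul' := fun m t c x => by
        obtain ⟨b, rfl⟩ := hf c
        rw [smul₁, smulN]
        convert G₀.map_update_smul m t b x
      map_eq_zero_of_eq' := fun m a b hab hne => G₀.map_eq_zero_of_eq m hab hne }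
  let Ψ := exteriorPower.alternatingMapLinearEquiv (M := Ω[C⁄k]) (N := N) (G.compLinearMap ψ)
  have hΨ (η : OmegaPow k B i) : (Ψ (omegaMap f i η) : OmegaPow k B i) = (q ^ 2) ^ i • η := by
    induction η using omegaPow_induction with
    | ιMulti m =>
      rw [omegaMap_ιMulti, exteriorPower.alternatingMapLinearEquiv_apply_ιMulti]
      change exteriorPower.ιMulti B i (fun t => (ψ (kaehlerMap f (m t)) : Ω[B⁄k])) = _
      simp only [hψ]
      have h := (exteriorPower.ιMulti B i).map_smul_univ (fun _ => q ^ 2) m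
      rwa [Finset.prod_const, Finset.card_univ, Fintype.card_fin] at h
    | zero => simp
    | add x y hx hy => rw [map_add, map_add, Submodule.coe_add, hx, hy, smul_add]
    | smul b x hx =>
      rw [LinearMap.map_smulₛₗ, map_smul]
      change ((f b • Ψ (omegaMap f i x) : N) : OmegaPow k B i) = _
      rw [smulN, Submodule.coe_smul, hx, smul_comm]
  rw [← hΨ, hω, map_zero, Submodule.coe_zero]

end Kernel

section Torsion

variable {k S T : Type*} [CommRing k] [CommRing S] [Algebra k S] [CommRing T] [Algebra k T]

lemma omegaMap_mem_torsion (f : S →ₐ[k] T)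
    (hf : ∀ s ∈ nonZeroDivisors S, f s ∈ nonZeroDivisors T) {i : ℕ} {ω : OmegaPow k S i}
    (hω : ω ∈ Submodule.torsion S (OmegaPow k S i)) :
    omegaMap f i ω ∈ Submodule.torsion T (OmegaPow k T i) := by
  obtain ⟨⟨s, hs⟩, h⟩ := hω
  refine ⟨⟨f s, hf s hs⟩, ?_⟩
  have h' := congrArg (omegaMap f i) h
  rw [map_zero] at h'
  exact (LinearMap.map_smulₛₗ (omegaMap f i) s ω).symm.trans h'

end Torsion

section NormalCrossing

variable {k σ : Type*} [Field k]

/-- `Ω^i_S` is torsion-free when `S` is a retract of a polynomial ring. -/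
lemma torsion_omegaPow_eq_bot_of_retract {S : Type*} [CommRing S] [Nontrivial S]
    [Algebra k S] (f : S →ₐ[k] MvPolynomial σ k) (g : MvPolynomial σ k →ₐ[k] S)
    (hgf : ∀ s, g (f s) = s) (i : ℕ) : Submodule.torsion S (OmegaPow k S i) = ⊥ := by
  rw [eq_bot_iff]
  intro ω hω
  have hf : Function.Injective f := Function.LeftInverse.injective hgf
  have h := omegaMap_mem_torsion f (fun s hs => mem_nonZeroDivisors_of_ne_zero
    ((map_ne_zero_iff f hf).2 (nonZeroDivisors.ne_zero hs))) hω
  have : Module.Free (MvPolynomial σ k) (Ω[MvPolynomial σ k⁄k]) :=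
    .of_basis (KaehlerDifferential.mvPolynomialBasis k σ)
  have h0 : Submodule.torsion (MvPolynomial σ k) (OmegaPow k (MvPolynomial σ k) i) = ⊥ :=
    Submodule.isTorsionFree_iff_torsion_eq_bot.1 inferInstance
  rw [h0, Submodule.mem_bot] at h
  exact omegaMap_injective_of_leftInverse f g hgf i (h.trans (map_zero _).symm)

lemma prod_X_dvd {s : Finset σ} {f : MvPolynomial σ k} (h : ∀ j ∈ s, X j ∣ f) :
    ∏ j ∈ s, X j ∣ f := by
  refine Finset.prod_dvd_of_isRelPrime (fun i _ j _ hij => ?_) h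
  exact (X_prime.irreducible.isRelPrime_iff_not_dvd).2 fun hd => hij (X_dvd_X.1 hd)

lemma X_dvd_prod_X_iff {s : Finset σ} {i : σ} :
    (X i : MvPolynomial σ k) ∣ ∏ j ∈ s, X j ↔ i ∈ s := by
  rw [X_prime.dvd_finsetProd_iff]
  simp

/-- The nonzerodivisors on a union of coordinate hyperplanes are the functions that vanish
identically on none of these hyperplanes. -/
lemma mk_mem_nonZeroDivisors_iff (s : Finset σ) (f : MvPolynomial σ k) :
    Ideal.Quotient.mk (Ideal.span {∏ j ∈ s, (X j : MvPolynomial σ k)}) f ∈ nonZeroDivisors _ ↔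
      ∀ j ∈ s, ¬ X j ∣ f := by
  classical
  rw [mem_nonZeroDivisors_iff_right]
  constructor
  · rintro h j hj ⟨c, rfl⟩
    have h1 := h (Ideal.Quotient.mk _ (∏ l ∈ s.erase j, X l)) (by
      rw [← map_mul, Ideal.Quotient.eq_zero_iff_mem, Ideal.mem_span_singleton,
        ← Finset.prod_erase_mul s _ hj, ← mul_assoc]
      exact dvd_mul_right _ _)
    rw [Ideal.Quotient.eq_zero_iff_mem, Ideal.mem_span_singleton] at h1
    have h2 := X_dvd_prod_X_iff.1 ((X_dvd_prod_X_iff.2 hj).trans h1)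
    simp at h2
  · intro h x hx
    obtain ⟨a, rfl⟩ := Ideal.Quotient.mk_surjective x
    rw [← map_mul, Ideal.Quotient.eq_zero_iff_mem, Ideal.mem_span_singleton] at hx
    rw [Ideal.Quotient.eq_zero_iff_mem, Ideal.mem_span_singleton]
    refine prod_X_dvd fun j hj => ?_
    exact (X_dvd_mul_iff.1 ((X_dvd_prod_X_iff.2 hj).trans hx)).resolve_right (h j hj)

/-- The quotient of `k[x_j]` by a single variable is a retract of `k[x_j]`. -/
lemma torsion_omegaPow_quotient_X_eq_bot (j : σ) (i : ℕ) :
    Submodule.torsion (MvPolynomial σ k ⧸ Ideal.span {(X j : MvPolynomial σ k)})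
      (OmegaPow k (MvPolynomial σ k ⧸ Ideal.span {(X j : MvPolynomial σ k)}) i) = ⊥ := by
  classical
  set I := Ideal.span {(X j : MvPolynomial σ k)}
  have : Nontrivial (MvPolynomial σ k ⧸ I) := Ideal.Quotient.nontrivial_iff.2 fun h =>
    X_prime.not_isUnit (Ideal.span_singleton_eq_top.1 h)
  let e : MvPolynomial σ k →ₐ[k] MvPolynomial σ k := aeval (Function.update X j 0)
  have he : ∀ a ∈ I, e a = 0 := fun a ha => by
    obtain ⟨c, rfl⟩ := Ideal.mem_span_singleton.1 ha
    simp [e]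
  have hcomp : (Ideal.Quotient.mkₐ k I).comp e = Ideal.Quotient.mkₐ k I := by
    ext l
    by_cases hl : l = j
    · subst hl
      simp [e, I]
    · simp [e, hl]
  refine torsion_omegaPow_eq_bot_of_retract (Ideal.Quotient.liftₐ I e he)
    (Ideal.Quotient.mkₐ k I) (fun s => ?_) i
  obtain ⟨a, rfl⟩ := Ideal.Quotient.mk_surjective s
  exact DFunLike.congr_fun hcomp a

end NormalCrossing

/-- Restriction along an inclusion of ideals, as a `k`-algebra morphism. -/
noncomputable abbrev quotientRestrict (k : Type*) {A : Type*} [CommRing k] [CommRing A]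
    [Algebra k A] {I J : Ideal A} (h : I ≤ J) : A ⧸ I →ₐ[k] A ⧸ J :=
  Ideal.Quotient.liftₐ I (Ideal.Quotient.mkₐ k J) fun _ ha =>
    Ideal.Quotient.eq_zero_iff_mem.2 (h ha)

lemma quotientRestrict_surjective (k : Type*) {A : Type*} [CommRing k] [CommRing A]
    [Algebra k A] {I J : Ideal A} (h : I ≤ J) : Function.Surjective (quotientRestrict k h) :=
  fun x => by
    obtain ⟨a, rfl⟩ := Ideal.Quotient.mk_surjective x
    exact ⟨Ideal.Quotient.mk I a, rfl⟩

/-- If `I = (p q)` then `q` annihilates the kernel of `A/I → A/(p)`. -/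
lemma mul_eq_zero_of_quotientRestrict_eq_zero {k A : Type*} [CommRing k] [CommRing A]
    [Algebra k A] {p q r : A} (hr : p * q = r)
    (h : Ideal.span {r} ≤ Ideal.span {p}) (b : A ⧸ Ideal.span {r})
    (hb : quotientRestrict k h b = 0) : Ideal.Quotient.mk (Ideal.span {r}) q * b = 0 := by
  obtain ⟨a, rfl⟩ := Ideal.Quotient.mk_surjective b
  obtain ⟨c, rfl⟩ := Ideal.mem_span_singleton.1 (Ideal.Quotient.eq_zero_iff_mem.1 hb)
  rw [← map_mul, Ideal.Quotient.eq_zero_iff_mem, Ideal.mem_span_singleton]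
  exact ⟨c, by rw [← hr]; ring⟩

/-- A form on `E` that vanishes on `E₁` and is torsion on the other components is torsion. -/
lemma mem_torsion_of_restrictions (k : Type*) [Field k] (n i : ℕ) (hi : 1 ≤ i)
    (h₁ : idealR k n ≤ idealR1 k n) (h₂ : idealR k n ≤ idealR2 k n)
    (ω : OmegaPow k (ringR k n) i) (hω₁ : omegaMap (quotientRestrict k h₁) i ω = 0)
    (hω₂ : omegaMap (quotientRestrict k h₂) i ω ∈
      Submodule.torsion (ringR2 k n) (OmegaPow k (ringR2 k n) i)) :
    ω ∈ Submodule.torsion (ringR k n) (OmegaPow k (ringR k n) i) := by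
  have hprod : (X 0 : polyA k n) * ∏ j ∈ Finset.univ.erase 0, X j = ∏ j, X j :=
    Finset.mul_prod_erase _ _ (Finset.mem_univ _)
  set q : polyA k n := ∏ j ∈ Finset.univ.erase 0, X j with hqdef
  obtain ⟨⟨g', hg'⟩, hg⟩ := hω₂
  obtain ⟨g, rfl⟩ := Ideal.Quotient.mk_surjective g'
  rw [mk_mem_nonZeroDivisors_iff] at hg'
  have e₁ := pow_smul_eq_zero_of_omegaMap_eq_zero (quotientRestrict k h₁)
    (quotientRestrict_surjective k h₁) (Ideal.Quotient.mk _ q)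
    (mul_eq_zero_of_quotientRestrict_eq_zero hprod h₁) hi ω hω₁
  have e₂ := pow_smul_eq_zero_of_omegaMap_eq_zero (quotientRestrict k h₂)
    (quotientRestrict_surjective k h₂) (Ideal.Quotient.mk _ (X 0))
    (mul_eq_zero_of_quotientRestrict_eq_zero ((mul_comm _ _).trans hprod) h₂) hi
    (Ideal.Quotient.mk _ g • ω)
    ((LinearMap.map_smulₛₗ (omegaMap (quotientRestrict k h₂) i) _ ω).trans hg)
  refine ⟨⟨Ideal.Quotient.mk _ ((q ^ 2) ^ i + (X 0 ^ 2) ^ i * g), ?_⟩, ?_⟩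
  · rw [mk_mem_nonZeroDivisors_iff]
    intro j _ hdvd
    have hne : i ≠ 0 := by omega
    by_cases hj : j = 0
    · subst hj
      rw [dvd_add_left (dvd_mul_of_dvd_left (dvd_pow (dvd_pow_self _ two_ne_zero) hne) _)] at hdvd
      have := X_prime.dvd_of_dvd_pow (X_prime.dvd_of_dvd_pow hdvd)
      rw [hqdef, X_dvd_prod_X_iff] at this
      simp at this
    · have hjq : (X j : polyA k n) ∣ q := X_dvd_prod_X_iff.2 (by simp [hj])
      rw [dvd_add_right (dvd_pow (dvd_pow hjq two_ne_zero) hne)] at hdvd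
      rcases X_dvd_mul_iff.1 hdvd with h | h
      · exact hj (X_dvd_X.1 (X_prime.dvd_of_dvd_pow (X_prime.dvd_of_dvd_pow h)))
      · exact hg' j (by simp [hj]) h
  · change Ideal.Quotient.mk (idealR k n) ((q ^ 2) ^ i + (X 0 ^ 2) ^ i * g) • ω = 0
    rw [map_add, map_mul, map_pow, map_pow, map_pow, map_pow, add_smul, mul_smul,
      e₁, e₂, add_zero]

/-- **Claim 1 of the appendix Theorem.**  The canonical map
`φ : Ω^i_R/tors → (Ω^i_{R₂}/tors) ⊕ Ω^i_{R₁}`, given in both coordinates by the canonical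
restriction maps induced by the quotients `R → R₂` and `R → R₁`, is injective (`i ≥ 1`).
The map `φ` is pinned down by its values on the generators
`a₀ • (d a₁ ∧ ⋯ ∧ d a_i)` (images of elements of `A`), which generate `Ω^i_R/tors`. -/
theorem stmt5 (k : Type*) [Field k] (n i : ℕ) (hi : 1 ≤ i) :
    ∃ φ : OmegaPowModTors k (ringR k n) i →+
        (OmegaPowModTors k (ringR2 k n) i) × (OmegaPow k (ringR1 k n) i),
      (∀ (a₀ : polyA k n) (v : Fin i → polyA k n),
        φ (omegaGenTors k (ringR k n) i (Ideal.Quotient.mk (idealR k n) a₀)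
            fun t => Ideal.Quotient.mk (idealR k n) (v t))
          = (omegaGenTors k (ringR2 k n) i (Ideal.Quotient.mk (idealR2 k n) a₀)
               fun t => Ideal.Quotient.mk (idealR2 k n) (v t),
             omegaGen k (ringR1 k n) i (Ideal.Quotient.mk (idealR1 k n) a₀)
               fun t => Ideal.Quotient.mk (idealR1 k n) (v t))) ∧
      Function.Injective φ := by
  have hprod : (X 0 : polyA k n) * ∏ j ∈ Finset.univ.erase 0, X j = ∏ j, X j :=
    Finset.mul_prod_erase _ _ (Finset.mem_univ _)
  have h₁ : idealR k n ≤ idealR1 k n :=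
    Ideal.span_singleton_le_span_singleton.2 ⟨_, hprod.symm⟩
  have h₂ : idealR k n ≤ idealR2 k n :=
    Ideal.span_singleton_le_span_singleton.2 ⟨_, ((mul_comm _ _).trans hprod).symm⟩
  have nzd₁ : ∀ s ∈ nonZeroDivisors (ringR k n),
      quotientRestrict k h₁ s ∈ nonZeroDivisors (ringR1 k n) := by
    intro s hs
    obtain ⟨a, rfl⟩ := Ideal.Quotient.mk_surjective s
    have h := (mk_mem_nonZeroDivisors_iff ({0} : Finset (Fin (n + 1))) a).2 fun j _ =>
      (mk_mem_nonZeroDivisors_iff _ _).1 hs j (Finset.mem_univ j)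
    rw [Finset.prod_singleton] at h
    exact h
  have nzd₂ : ∀ s ∈ nonZeroDivisors (ringR k n),
      quotientRestrict k h₂ s ∈ nonZeroDivisors (ringR2 k n) := by
    intro s hs
    obtain ⟨a, rfl⟩ := Ideal.Quotient.mk_surjective s
    exact (mk_mem_nonZeroDivisors_iff _ a).2 fun j _ =>
      (mk_mem_nonZeroDivisors_iff _ _).1 hs j (Finset.mem_univ j)
  let φ₁ := (Submodule.torsion (ringR k n) (OmegaPow k (ringR k n) i)).liftQ
    (omegaMap (quotientRestrict k h₁) i) fun ω hω => by
      have h := omegaMap_mem_torsion (quotientRestrict k h₁) nzd₁ hω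
      rwa [torsion_omegaPow_quotient_X_eq_bot] at h
  let φ₂ := (Submodule.torsion (ringR k n) (OmegaPow k (ringR k n) i)).liftQ
    ((Submodule.torsion (ringR2 k n) (OmegaPow k (ringR2 k n) i)).mkQ.comp
      (omegaMap (quotientRestrict k h₂) i)) fun ω hω =>
        (Submodule.Quotient.mk_eq_zero _).2
          (omegaMap_mem_torsion (quotientRestrict k h₂) nzd₂ hω)
  refine ⟨φ₂.toAddMonoidHom.prod φ₁.toAddMonoidHom, fun a₀ v => ?_, ?_⟩
  · refine Prod.ext ?_ ?_
    · exact congrArg Submodule.Quotient.mk (omegaMap_omegaGen (quotientRestrict k h₂) i _ _)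
    · exact omegaMap_omegaGen (quotientRestrict k h₁) i _ _
  · rw [injective_iff_map_eq_zero]
    intro x hx
    obtain ⟨ω, rfl⟩ := Submodule.Quotient.mk_surjective _ x
    exact (Submodule.Quotient.mk_eq_zero _).2 (mem_torsion_of_restrictions k n i hi h₁ h₂ ω
      (congrArg Prod.snd hx) ((Submodule.Quotient.mk_eq_zero _).1 (congrArg Prod.fst hx)))
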